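/- There exist constants c₁, c₂ > 0 such that for every n ≥ 16, the price of anarchy of the SUM swap game on n-vertex trees by weakly pessimistic players with 3-local information satisfies c₁·n ≤ PoA_SUM(n, n−1, 3) ≤ c₂·n. -/

import Mathlib

open SimpleGraph

namespace SwapGame

/-- The set of vertices within distance `k` of `u` in `G` (the `k`-neighborhood). -/
def ball {V : Type} (G : SimpleGraph V) (u : V) (k : ℕ) : Set V :=
  {v | G.edist u v ≤ (k : ℕ∞)}

/-- The graph obtained from `G` by the edge swap `(v, w)` at `u`:
remove the edge `{u, v}` and add the edge `{u, w}`. -/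
def swapGraph {V : Type} (G : SimpleGraph V) (u v w : V) : SimpleGraph V :=
  SimpleGraph.fromEdgeSet ((G.edgeSet \ {s(u, v)}) ∪ {s(u, w)})

/-- The edge swap `(v, w)` at `u` is a legal move for a player with `k`-local information:
`v` is a neighbor of `u` and `w` is a non-neighbor (other than `u`) within distance `k`. -/
def ValidSwap {V : Type} (G : SimpleGraph V) (k : ℕ) (u v w : V) : Prop :=
  G.Adj u v ∧ G.edist u w ≤ (k : ℕ∞) ∧ ¬ G.Adj u w ∧ w ≠ u

/-- `H` (a graph on `W`, with `ι` identifying the view inside `H`) is a finite connected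
graph compatible with `u`'s `k`-local view in `G`. -/
def Compatible {V : Type} (G : SimpleGraph V) (k : ℕ) (u : V)
    {W : Type} (H : SimpleGraph W) (ι : V → W) : Prop :=
  Finite W ∧ H.Connected ∧ Set.InjOn ι (ball G u k) ∧
  {x : W | H.edist (ι u) x ≤ (k : ℕ∞)} = ι '' ball G u k ∧
  ∀ a ∈ ball G u k, ∀ b ∈ ball G u k, (H.Adj (ι a) (ι b) ↔ G.Adj a b)

/-- SUM-cost of player `u` in `H` (`⊤` when `H` is disconnected). -/
noncomputable def cSum {W : Type} (H : SimpleGraph W) (u : W) : ℕ∞ :=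
  ∑' v, H.edist u v

/-- MAX-cost (eccentricity) of player `u` in `H` (`⊤` when `H` is disconnected). -/
noncomputable def cMax {W : Type} (H : SimpleGraph W) (u : W) : ℕ∞ :=
  ⨆ v, H.edist u v

/-- A pessimistic player `u` with `k`-local information is unhappy in `G` w.r.t. the
SUM-cost via the edge swap `(v, w)`: the swap strictly decreases `u`'s cost in every
compatible global graph. -/
def UnhappySumVia {V : Type} (G : SimpleGraph V) (k : ℕ) (u v w : V) : Prop :=
  ValidSwap G k u v w ∧
  ∀ (W : Type) (H : SimpleGraph W) (ι : V → W), Compatible G k u H ι →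
    cSum (swapGraph H (ι u) (ι v) (ι w)) (ι u) < cSum H (ι u)

/-- Pessimistic unhappiness w.r.t. the MAX-cost via the edge swap `(v, w)`. -/
def UnhappyMaxVia {V : Type} (G : SimpleGraph V) (k : ℕ) (u v w : V) : Prop :=
  ValidSwap G k u v w ∧
  ∀ (W : Type) (H : SimpleGraph W) (ι : V → W), Compatible G k u H ι →
    cMax (swapGraph H (ι u) (ι v) (ι w)) (ι u) < cMax H (ι u)

/-- Weakly pessimistic unhappiness w.r.t. the SUM-cost via the edge swap `(v, w)`:
the swap does not increase `u`'s cost in any compatible global graph. -/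
def WeakUnhappySumVia {V : Type} (G : SimpleGraph V) (k : ℕ) (u v w : V) : Prop :=
  ValidSwap G k u v w ∧
  ∀ (W : Type) (H : SimpleGraph W) (ι : V → W), Compatible G k u H ι →
    cSum (swapGraph H (ι u) (ι v) (ι w)) (ι u) ≤ cSum H (ι u)

/-- Weakly pessimistic unhappiness w.r.t. the MAX-cost via the edge swap `(v, w)`. -/
def WeakUnhappyMaxVia {V : Type} (G : SimpleGraph V) (k : ℕ) (u v w : V) : Prop :=
  ValidSwap G k u v w ∧
  ∀ (W : Type) (H : SimpleGraph W) (ι : V → W), Compatible G k u H ι →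
    cMax (swapGraph H (ι u) (ι v) (ι w)) (ι u) ≤ cMax H (ι u)

/-- Optimistic unhappiness w.r.t. the SUM-cost via the edge swap `(v, w)`:
the swap strictly decreases `u`'s cost in some compatible global graph
(with the swapped graph connected). -/
def OptUnhappySumVia {V : Type} (G : SimpleGraph V) (k : ℕ) (u v w : V) : Prop :=
  ValidSwap G k u v w ∧
  ∃ (W : Type) (H : SimpleGraph W) (ι : V → W), Compatible G k u H ι ∧
    (swapGraph H (ι u) (ι v) (ι w)).Connected ∧
    cSum (swapGraph H (ι u) (ι v) (ι w)) (ι u) < cSum H (ι u)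

/-- Optimistic unhappiness w.r.t. the MAX-cost via the edge swap `(v, w)`. -/
def OptUnhappyMaxVia {V : Type} (G : SimpleGraph V) (k : ℕ) (u v w : V) : Prop :=
  ValidSwap G k u v w ∧
  ∃ (W : Type) (H : SimpleGraph W) (ι : V → W), Compatible G k u H ι ∧
    (swapGraph H (ι u) (ι v) (ι w)).Connected ∧
    cMax (swapGraph H (ι u) (ι v) (ι w)) (ι u) < cMax H (ι u)

/-- Sum-swap equilibrium for pessimistic players with `k`-local information. -/
def SumEquilibrium {V : Type} (G : SimpleGraph V) (k : ℕ) : Prop :=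
  ∀ u : V, ¬ ∃ v w, UnhappySumVia G k u v w

/-- Max-swap equilibrium for pessimistic players with `k`-local information. -/
def MaxEquilibrium {V : Type} (G : SimpleGraph V) (k : ℕ) : Prop :=
  ∀ u : V, ¬ ∃ v w, UnhappyMaxVia G k u v w

/-- Sum-swap equilibrium for weakly pessimistic players with `k`-local information. -/
def WeakSumEquilibrium {V : Type} (G : SimpleGraph V) (k : ℕ) : Prop :=
  ∀ u : V, ¬ ∃ v w, WeakUnhappySumVia G k u v w

/-- Max-swap equilibrium for weakly pessimistic players with `k`-local information. -/
def WeakMaxEquilibrium {V : Type} (G : SimpleGraph V) (k : ℕ) : Prop :=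
  ∀ u : V, ¬ ∃ v w, WeakUnhappyMaxVia G k u v w

/-- Sum-swap equilibrium for optimistic players with `k`-local information. -/
def OptSumEquilibrium {V : Type} (G : SimpleGraph V) (k : ℕ) : Prop :=
  ∀ u : V, ¬ ∃ v w, OptUnhappySumVia G k u v w

/-- Max-swap equilibrium for optimistic players with `k`-local information. -/
def OptMaxEquilibrium {V : Type} (G : SimpleGraph V) (k : ℕ) : Prop :=
  ∀ u : V, ¬ ∃ v w, OptUnhappyMaxVia G k u v w

/-- Social SUM-cost of a (connected, finite) graph, as a natural number. -/
noncomputable def scSum {W : Type} [Fintype W] (H : SimpleGraph W) : ℕ :=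
  ∑ u : W, ∑ v : W, H.dist u v

/-- Social MAX-cost of a (connected, finite) graph, as a natural number. -/
noncomputable def scMax {W : Type} [Fintype W] (H : SimpleGraph W) : ℕ :=
  ∑ u : W, Finset.univ.sup (H.dist u)

/-- Price of anarchy over `n`-vertex trees for a given notion of equilibrium and
social cost: (max social cost of an equilibrium tree) / (min social cost of a tree). -/
noncomputable def PoA (n : ℕ) (eqPred : SimpleGraph (Fin n) → Prop)
    (sc : SimpleGraph (Fin n) → ℕ) : ℚ :=
  ((sSup {m : ℕ | ∃ T : SimpleGraph (Fin n), T.IsTree ∧ eqPred T ∧ sc T = m} : ℕ) : ℚ) /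
  ((sInf {m : ℕ | ∃ T : SimpleGraph (Fin n), T.IsTree ∧ sc T = m} : ℕ) : ℚ)


section Potential

variable {W : Type} {H : SimpleGraph W}

theorem le_edist_of_potential {f : W → ℕ} {u : W} (hu : f u = 0)
    (hf : ∀ a b, H.Adj a b → f b ≤ f a + 1) (y : W) : (f y : ℕ∞) ≤ H.edist u y := by
  have key : ∀ a b (p : H.Walk a b), f b ≤ f a + p.length := by
    intro a b p
    induction p with
    | nil => simp
    | cons h p ih =>
      have := hf _ _ h
      simp only [Walk.length_cons]
      omega
  refine le_iInf fun p => ?_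
  have := key _ _ p
  rw [hu, zero_add] at this
  exact_mod_cast this

theorem swapGraph_adj {u v w a b : W} :
    (swapGraph H u v w).Adj a b ↔
      ((H.Adj a b ∧ s(a, b) ≠ s(u, v)) ∨ s(a, b) = s(u, w)) ∧ a ≠ b := by
  simp only [swapGraph, fromEdgeSet_adj, Set.mem_union, Set.mem_sdiff, mem_edgeSet,
    Set.mem_singleton_iff, ne_eq]

/-- Lower bound the cost after the swap by a potential `f`, and the cost before it by `g`. -/
theorem cSum_lt_cSum_swapGraph [Fintype W] {u v w : W} (f g : W → ℕ) (hu : f u = 0)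
    (hw : f w ≤ 1)
    (hf : ∀ a b, H.Adj a b → s(a, b) ≠ s(u, v) → f b ≤ f a + 1)
    (hg : ∀ y, H.edist u y ≤ g y) (hlt : ∑ y, g y < ∑ y, f y) :
    cSum H u < cSum (swapGraph H u v w) u := by
  have h1 : cSum H u ≤ ((∑ y, g y : ℕ) : ℕ∞) := by
    rw [cSum, tsum_fintype]
    push_cast
    exact Finset.sum_le_sum fun y _ => hg y
  have h2 : ((∑ y, f y : ℕ) : ℕ∞) ≤ cSum (swapGraph H u v w) u := by
    rw [cSum, tsum_fintype]
    push_cast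
    refine Finset.sum_le_sum fun y _ => le_edist_of_potential hu (fun a b hab => ?_) y
    rw [swapGraph_adj] at hab
    obtain ⟨⟨h, h'⟩ | h, hne⟩ := hab
    · exact hf a b h h'
    · rw [Sym2.eq_iff] at h
      obtain ⟨rfl, rfl⟩ | ⟨rfl, rfl⟩ := h <;> omega
  exact h1.trans_lt (lt_of_lt_of_le (by exact_mod_cast hlt) h2)

end Potential

section Tree

variable {V : Type} {T : SimpleGraph V}

/-- The vertices on the `v`-side of the edge `uv`. -/
def branch (T : SimpleGraph V) (u v : V) : Set V :=
  {y | (T.deleteEdges {s(u, v)}).Reachable v y}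

theorem mem_branch_self {u v : V} : v ∈ branch T u v := Reachable.refl _

theorem notMem_branch (hT : T.IsTree) {u v : V} (h : T.Adj u v) : u ∉ branch T u v := by
  have := isAcyclic_iff_forall_adj_isBridge.1 hT.isAcyclic h
  rw [isBridge_iff] at this
  exact fun h' => this (Reachable.symm h')

theorem mem_branch_of_adj {u v a b : V} (ha : a ∈ branch T u v) (hab : T.Adj a b)
    (hne : s(a, b) ≠ s(u, v)) : b ∈ branch T u v := by
  refine Reachable.trans ha (Adj.reachable ?_)
  simp [deleteEdges_adj, hab, hne]

theorem mem_branch_iff_of_adj {u v a b : V} (hab : T.Adj a b)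
    (hne : s(a, b) ≠ s(u, v)) : a ∈ branch T u v ↔ b ∈ branch T u v :=
  ⟨fun h => mem_branch_of_adj h hab hne,
    fun h => mem_branch_of_adj h hab.symm (by rwa [Sym2.eq_swap])⟩

theorem eq_of_crossing (hT : T.IsTree) {u v a b : V} (huv : T.Adj u v) (hab : T.Adj a b)
    (ha : a ∉ branch T u v) (hb : b ∈ branch T u v) : a = u ∧ b = v := by
  have : s(a, b) = s(u, v) := by
    by_contra hne
    exact ha ((mem_branch_iff_of_adj hab hne).2 hb)
  rw [Sym2.eq_iff] at this
  obtain h | ⟨rfl, rfl⟩ := this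
  · exact h
  · exact absurd hb (notMem_branch hT huv)

theorem dist_eq_two (hT : T.IsTree) {a b c : V} (hab : T.Adj a b) (hbc : T.Adj b c)
    (hac : a ≠ c) : T.dist a c = 2 := by
  let p : T.Walk a c := .cons hab (.cons hbc .nil)
  have hp : p.IsPath := by
    rw [hT.isAcyclic.isPath_iff_isChain]
    simp [p, hac, hab.ne]
  obtain ⟨q, hq, hl⟩ := hT.connected.exists_path_of_dist a c
  rw [← hl, (hT.existsUnique_path a c).unique hq hp]
  rfl

theorem dist_eq_three (hT : T.IsTree) {a b c d : V} (hab : T.Adj a b) (hbc : T.Adj b c)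
    (hcd : T.Adj c d) (hac : a ≠ c) (hbd : b ≠ d) : T.dist a d = 3 := by
  let p : T.Walk a d := .cons hab (.cons hbc (.cons hcd .nil))
  have hp : p.IsPath := by
    rw [hT.isAcyclic.isPath_iff_isChain]
    simp [p, hac, hbd, hab.ne, hbc.ne]
  obtain ⟨q, hq, hl⟩ := hT.connected.exists_path_of_dist a d
  rw [← hl, (hT.existsUnique_path a d).unique hq hp]
  rfl

theorem dist_eq_four (hT : T.IsTree) {a b c d e : V} (hab : T.Adj a b) (hbc : T.Adj b c)
    (hcd : T.Adj c d) (hde : T.Adj d e) (hac : a ≠ c) (hbd : b ≠ d) (hce : c ≠ e) :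
    T.dist a e = 4 := by
  let p : T.Walk a e := .cons hab (.cons hbc (.cons hcd (.cons hde .nil)))
  have hp : p.IsPath := by
    rw [hT.isAcyclic.isPath_iff_isChain]
    simp [p, hac, hbd, hce, hab.ne, hbc.ne, hcd.ne]
  obtain ⟨q, hq, hl⟩ := hT.connected.exists_path_of_dist a e
  rw [← hl, (hT.existsUnique_path a e).unique hq hp]
  rfl

theorem exists_walk_of_edist_le_three (hT : T.IsTree) {u w : V}
    (h : T.edist u w ≤ (3 : ℕ)) :
    w = u ∨ T.Adj u w ∨ (∃ a, T.Adj u a ∧ T.Adj a w) ∨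
      ∃ a b, T.Adj u a ∧ T.Adj a b ∧ T.Adj b w := by
  obtain ⟨p, hp⟩ := hT.connected.exists_walk_length_eq_dist u w
  have h3 : p.length ≤ 3 := by
    rw [← (hT.connected u w).coe_dist_eq_edist] at h
    rw [hp]; exact_mod_cast h
  clear hp h
  match p, h3 with
  | .nil, _ => simp
  | .cons h .nil, _ => simp [h]
  | .cons h (.cons h' .nil), _ => exact .inr (.inr (.inl ⟨_, h, h'⟩))
  | .cons h (.cons h' (.cons h'' .nil)), _ => exact .inr (.inr (.inr ⟨_, _, h, h', h''⟩))
  | .cons _ (.cons _ (.cons _ (.cons _ _))), h3 => simp at h3; omega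

/-- A legal swap that stays in the branch moves to a child or grandchild of the old neighbour. -/
theorem ValidSwap.child_or_grandchild (hT : T.IsTree) {u v w : V} (h : ValidSwap T 3 u v w)
    (hw : w ∈ branch T u v) :
    T.Adj v w ∨ ∃ x, T.Adj v x ∧ T.Adj x w ∧ x ≠ u ∧ w ≠ v := by
  obtain ⟨huv, hd, hna, hne⟩ := h
  have hu := notMem_branch hT huv
  obtain rfl | h | ⟨a, h1, h2⟩ | ⟨a, b, h1, h2, h3⟩ := exists_walk_of_edist_le_three hT hd
  · exact absurd rfl hne
  · exact absurd h hna
  · by_cases ha : a ∈ branch T u v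
    · obtain ⟨-, rfl⟩ := eq_of_crossing hT huv h1 hu ha
      exact .inl h2
    · obtain ⟨rfl, -⟩ := eq_of_crossing hT huv h2 ha hw
      exact absurd h2 hna
  · have hwv : w ≠ v := by rintro rfl; exact hna huv
    have hbu : b ≠ u := by rintro rfl; exact hna h3
    by_cases ha : a ∈ branch T u v
    · obtain ⟨-, rfl⟩ := eq_of_crossing hT huv h1 hu ha
      exact .inr ⟨b, h2, h3, hbu, hwv⟩
    · by_cases hb : b ∈ branch T u v
      · obtain ⟨rfl, -⟩ := eq_of_crossing hT huv h2 ha hb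
        exact absurd rfl h1.ne
      · exact absurd (eq_of_crossing hT huv h3 hb hw).2 hwv

theorem compatible_id [Finite V] (hT : T.Connected) (k : ℕ) (u : V) : Compatible T k u T id :=
  ⟨inferInstance, hT, Function.injective_id.injOn, by simp [ball], by simp⟩

theorem not_weakUnhappySumVia_of_lt {k : ℕ} {u v w : V} {W : Type} {H : SimpleGraph W}
    {ι : V → W} (hc : Compatible T k u H ι)
    (hlt : cSum H (ι u) < cSum (swapGraph H (ι u) (ι v) (ι w)) (ι u)) :
    ¬ WeakUnhappySumVia T k u v w :=
  fun h => (h.2 W H ι hc).not_gt hlt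

/-- A swap that leaves the branch disconnects the tree. -/
theorem not_weakUnhappySumVia_of_notMem_branch [Finite V] (hT : T.IsTree) {k : ℕ} {u v w : V}
    (huv : T.Adj u v) (hw : w ∉ branch T u v) : ¬ WeakUnhappySumVia T k u v w := by
  classical
  have := Fintype.ofFinite V
  have hu := notMem_branch hT huv
  refine not_weakUnhappySumVia_of_lt (compatible_id hT.connected k u) ?_
  refine cSum_lt_cSum_swapGraph
    (fun y => if y ∈ branch T u v then (∑ z, T.dist u z) + 1 else 0) (fun y => T.dist u y)
    (by simp [hu]) (by simp [hw]) (fun a b hab hne => ?_)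
    (fun y => ((hT.connected u y).coe_dist_eq_edist).ge) ?_
  · have := mem_branch_iff_of_adj hab hne
    by_cases h : a ∈ branch T u v <;> simp_all
  · refine lt_of_lt_of_le ?_ (Finset.single_le_sum (fun _ _ => Nat.zero_le _)
      (Finset.mem_univ v))
    simp [mem_branch_self]

/-- The potential giving the distances from `u` after the swap. -/
theorem branch_potential (hT : T.IsTree) {u v w a b : V} [DecidablePred (· ∈ branch T u v)]
    (hab : T.Adj a b) (hne : s(a, b) ≠ s(u, v)) :
    (if b ∈ branch T u v then T.dist w b + 1 else T.dist u b) ≤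
      (if a ∈ branch T u v then T.dist w a + 1 else T.dist u a) + 1 := by
  have h1 := hT.connected.dist_triangle (u := w) (v := a) (w := b)
  have h2 := hT.connected.dist_triangle (u := u) (v := a) (w := b)
  have h3 := dist_eq_one_iff_adj.2 hab
  by_cases h : a ∈ branch T u v
  · simp only [h, (mem_branch_iff_of_adj hab hne).1 h, if_true]
    omega
  · simp only [h, mt (mem_branch_iff_of_adj hab hne).2 h, if_false]
    omega

end Tree

section Pendant

variable {V : Type} {T : SimpleGraph V}

/-- `T` together with `N` new leaves attached to the vertex `z`. -/
def pendant (T : SimpleGraph V) (z : V) (N : ℕ) : SimpleGraph (V ⊕ Fin N) where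
  Adj
    | .inl a, .inl b => T.Adj a b
    | .inl a, .inr _ => a = z
    | .inr _, .inl b => b = z
    | .inr _, .inr _ => False
  symm := ⟨by rintro (a | a) (b | b) h <;> first | exact h.symm | exact h⟩
  loopless := ⟨by rintro (a | a) h <;> first | exact h.ne rfl | exact h⟩

theorem edist_pendant_inl_le (hT : T.Connected) (z : V) (N : ℕ) (u y : V) :
    (pendant T z N).edist (.inl u) (.inl y) ≤ T.dist u y := by
  obtain ⟨p, hp⟩ := hT.exists_walk_length_eq_dist u y
  let φ : T →g pendant T z N := ⟨Sum.inl, fun h => h⟩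
  rw [← hp, ← Walk.length_map φ p]
  exact edist_le _

theorem edist_pendant_inr_le (hT : T.Connected) (z : V) (N : ℕ) (u : V) (i : Fin N) :
    (pendant T z N).edist (.inl u) (.inr i) ≤ (T.dist u z + 1 : ℕ) := by
  have h : (pendant T z N).Adj (.inl z) (.inr i) := rfl
  refine ((pendant T z N).edist_triangle (v := .inl z)).trans ?_
  rw [edist_eq_one_iff_adj.2 h]
  push_cast
  gcongr
  exact edist_pendant_inl_le hT z N u z

theorem connected_pendant (hT : T.Connected) (z : V) (N : ℕ) : (pendant T z N).Connected := by
  rw [connected_iff_exists_forall_reachable]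
  refine ⟨.inl z, ?_⟩
  rintro (y | i)
  · exact reachable_of_edist_ne_top
      ((edist_pendant_inl_le hT z N z y).trans_lt (ENat.natCast_lt_top _)).ne
  · exact Adj.reachable (show (pendant T z N).Adj (.inl z) (.inr i) from rfl)

theorem compatible_pendant [Finite V] (hT : T.Connected) {k : ℕ} {u z : V}
    (hz : T.dist u z = k) (N : ℕ) : Compatible T k u (pendant T z N) Sum.inl := by
  refine ⟨inferInstance, connected_pendant hT z N, Sum.inl_injective.injOn, ?_,
    fun _ _ _ _ => Iff.rfl⟩
  have key := le_edist_of_potential (H := pendant T z N) (u := .inl u)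
    (f := Sum.elim (T.dist u) fun _ => k + 1) (by simp) (by
      have hadj : ∀ a b, T.Adj a b → T.dist u b ≤ T.dist u a + 1 := fun a b h => by
        rw [← dist_eq_one_iff_adj.2 h]
        exact hT.dist_triangle
      rintro (a | a) (b | b) h
      · exact hadj a b h
      · obtain rfl : a = z := h
        simp [hz]
      · obtain rfl : b = z := h
        simp only [Sum.elim_inl, Sum.elim_inr]
        omega
      · exact h.elim)
  ext (y | i)
  · simp only [ball, Set.mem_ofPred_eq, Set.mem_image, Sum.inl.injEq, exists_eq_right]
    rw [← (hT u y).coe_dist_eq_edist]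
    exact ⟨(key (.inl y)).trans, (edist_pendant_inl_le hT z N u y).trans⟩
  · simp only [ball, Set.mem_ofPred_eq, Set.mem_image, reduceCtorEq, and_false, exists_false,
      iff_false, not_le]
    refine lt_of_lt_of_le ?_ (key (.inr i))
    simp only [Sum.elim_inr]
    exact_mod_cast Nat.lt_succ_self k

/-- If the branch contains a vertex on the border of the view that lies off the way to `w`, then
attaching many vertices to it makes the swap to `w` costly. -/
theorem not_weakUnhappySumVia_of_far [Finite V] (hT : T.IsTree) {k : ℕ} {u v w z : V}
    (huv : T.Adj u v) (hw : w ∈ branch T u v) (hz : z ∈ branch T u v) (hk : T.dist u z = k)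
    (hwz : k ≤ T.dist w z) : ¬ WeakUnhappySumVia T k u v w := by
  classical
  have := Fintype.ofFinite V
  have hu := notMem_branch hT huv
  set N := ∑ y, T.dist u y + 1 with hN
  refine not_weakUnhappySumVia_of_lt (compatible_pendant hT.connected hk N) ?_
  let f : V → ℕ := fun y => if y ∈ branch T u v then T.dist w y + 1 else T.dist u y
  have hfz : k + 1 ≤ f z := by simp only [f, hz, if_true]; omega
  refine cSum_lt_cSum_swapGraph (Sum.elim f fun _ => f z + 1)
    (Sum.elim (T.dist u) fun _ => k + 1) (by simp [f, hu]) (by simp [f, hw]) ?_ ?_ ?_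
  · rintro (a | a) (b | b) h hne
    · exact branch_potential hT h fun h' => hne (by simpa using h')
    · obtain rfl : a = z := h
      simp
    · obtain rfl : b = z := h
      simp only [Sum.elim_inl, Sum.elim_inr]
      omega
    · exact h.elim
  · rintro (y | i)
    · exact edist_pendant_inl_le hT.connected z N u y
    · rw [← hk]
      exact edist_pendant_inr_le hT.connected z N u i
  · simp only [Fintype.sum_sum_type, Sum.elim_inl, Sum.elim_inr, Finset.sum_const,
      Finset.card_univ, Fintype.card_fin, smul_eq_mul]
    have : N * (k + 1 + 1) ≤ N * (f z + 1) := Nat.mul_le_mul_left _ (by omega)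
    rw [Nat.mul_succ] at this
    omega

end Pendant

section Truncation

variable {V : Type} {T : SimpleGraph V}

theorem mem_ball {k : ℕ} {u y : V} : y ∈ ball T u k ↔ T.edist u y ≤ (k : ℕ∞) := Iff.rfl

theorem edist_induce_ball_le (hT : T.Connected) (k : ℕ) (u : V) (y : V) (hy : y ∈ ball T u k)
    (hu : u ∈ ball T u k) :
    (T.induce (ball T u k)).edist ⟨u, hu⟩ ⟨y, hy⟩ ≤ T.dist u y := by
  classical
  obtain ⟨p, hp⟩ := hT.exists_walk_length_eq_dist u y
  have hs : ∀ x ∈ p.support, x ∈ ball T u k := fun x hx => by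
    refine le_trans ?_ (mem_ball.1 hy)
    rw [← (hT u y).coe_dist_eq_edist, ← hp]
    exact (edist_le (p.takeUntil x hx)).trans (by exact_mod_cast p.length_takeUntil_le_length hx)
  rw [← hp]
  have h : (p.induce _ hs).length = p.length :=
    (Walk.length_map _ _).symm.trans (congrArg Walk.length (p.map_induce hs))
  rw [← h]
  exact edist_le _

theorem self_mem_ball (T : SimpleGraph V) (u : V) (k : ℕ) : u ∈ ball T u k := by simp [ball]

open Classical in
theorem compatible_induce_ball [Finite V] (hT : T.Connected) (k : ℕ) (u : V) :
    Compatible T k u (T.induce (ball T u k))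
      fun y => if h : y ∈ ball T u k then ⟨y, h⟩ else ⟨u, self_mem_ball T u k⟩ := by
  have hu := self_mem_ball T u k
  have hle : ∀ x : ball T u k, (T.induce (ball T u k)).edist ⟨u, hu⟩ x ≤ (k : ℕ∞) := fun x => by
    refine (edist_induce_ball_le hT k u x.1 x.2 hu).trans ?_
    rw [(hT u x.1).coe_dist_eq_edist]
    exact x.2
  refine ⟨inferInstance, ?_, ?_, ?_, ?_⟩
  · rw [connected_iff_exists_forall_reachable]
    exact ⟨⟨u, hu⟩, fun x =>
      reachable_of_edist_ne_top ((hle x).trans_lt (ENat.natCast_lt_top _)).ne⟩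
  · intro a ha b hb h
    simpa [ha, hb] using h
  · ext x
    simp only [hu, dif_pos, Set.mem_ofPred_eq, hle x, true_iff]
    exact ⟨x.1, x.2, by simp⟩
  · intro a ha b hb
    simp [ha, hb]

/-- Comparison of costs in the subgraph induced by the view. -/
theorem not_weakUnhappySumVia_of_ball [Fintype V] (hT : T.Connected) {k : ℕ} {u v w : V}
    (hv : v ∈ ball T u k) (hw : w ∈ ball T u k) (f : V → ℕ) (hfu : f u = 0) (hfw : f w ≤ 1)
    (hf : ∀ a b, T.Adj a b → s(a, b) ≠ s(u, v) → f b ≤ f a + 1)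
    [DecidablePred (· ∈ ball T u k)]
    (hlt : ∑ y with y ∈ ball T u k, T.dist u y < ∑ y with y ∈ ball T u k, f y) :
    ¬ WeakUnhappySumVia T k u v w := by
  classical
  have hu := self_mem_ball T u k
  have := Fintype.ofFinite (ball T u k)
  refine not_weakUnhappySumVia_of_lt (compatible_induce_ball hT k u) ?_
  simp only [hu, hv, hw, dif_pos]
  refine cSum_lt_cSum_swapGraph (fun y => f y.1) (fun y => T.dist u y.1) hfu hfw ?_ ?_ ?_
  · rintro ⟨a, ha⟩ ⟨b, hb⟩ h hne
    exact hf a b h fun h' => hne (by simpa using h')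
  · rintro ⟨y, hy⟩
    exact edist_induce_ball_le hT k u y hy hu
  · rw [Finset.sum_subtype (p := (· ∈ ball T u k)) _ (by simp),
      Finset.sum_subtype (p := (· ∈ ball T u k)) _ (by simp)] at hlt
    convert hlt

end Truncation

section Equilibrium

variable {V : Type} {T : SimpleGraph V}

theorem dist_eq_succ_of_forall_adj (hT : T.Connected) {v w y : V} (hvw : T.Adj v w)
    (hw : ∀ x, T.Adj w x → x = v) (hy : y ≠ w) : T.dist w y = T.dist v y + 1 := by
  apply le_antisymm
  · have := hT.dist_triangle (u := w) (v := v) (w := y)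
    rw [dist_eq_one_iff_adj.2 hvw.symm] at this
    omega
  · obtain ⟨p, hp⟩ := hT.exists_walk_length_eq_dist w y
    rw [← hp]
    cases p with
    | nil => exact absurd rfl hy
    | cons h p =>
      obtain rfl := hw _ h
      simpa using dist_le p

/-- Moving from a neighbour to one of the leaves attached to it does not pay off if the neighbour
has a further child. -/
theorem not_weakUnhappySumVia_leaf [Finite V] (hT : T.IsTree) {k : ℕ} {u v w l : V}
    (huv : T.Adj u v) (hvw : T.Adj v w) (hwu : w ≠ u) (hw : ∀ x, T.Adj w x → x = v)
    (hvl : T.Adj v l) (hlw : l ≠ w) (hlu : l ≠ u) : ¬ WeakUnhappySumVia T k u v w := by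
  classical
  have := Fintype.ofFinite V
  have hu := notMem_branch hT huv
  have hB : ∀ y, T.Adj v y → y ≠ u → y ∈ branch T u v := fun y h hne =>
    mem_branch_of_adj mem_branch_self h (by simp [hne, huv.ne'])
  refine not_weakUnhappySumVia_of_lt (compatible_id hT.connected k u) ?_
  refine cSum_lt_cSum_swapGraph
    (fun y => if y ∈ branch T u v then T.dist w y + 1 else T.dist u y) (fun y => T.dist u y)
    (by simp [hu]) (by simp [hB w hvw hwu]) (fun a b hab hne => branch_potential hT hab hne)
    (fun y => ((hT.connected u y).coe_dist_eq_edist).ge) ?_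
  have key : ∀ y ∈ Finset.univ, T.dist u y + (if y = v then 1 else 0) + (if y = l then 1 else 0)
      ≤ (if y ∈ branch T u v then T.dist w y + 1 else T.dist u y) + (if y = w then 1 else 0) := by
    intro y _
    have hvl' := hvl.ne
    by_cases hy : y ∈ branch T u v
    · obtain rfl | hyw := eq_or_ne y w
      · simp [hvw.ne', hlw.symm, hy, dist_eq_two hT huv hvw hwu.symm]
      · have h1 := dist_eq_succ_of_forall_adj hT.connected hvw hw hyw
        have h2 := hT.connected.dist_triangle (u := u) (v := v) (w := y)
        rw [dist_eq_one_iff_adj.2 huv] at h2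
        simp only [hy, if_true, hyw, if_false]
        split_ifs
        · grind
        all_goals omega
    · have h1 : y ≠ v := by rintro rfl; exact hy mem_branch_self
      have h2 : y ≠ l := by rintro rfl; exact hy (hB _ hvl hlu)
      simp [h1, h2, hy]
  have := Finset.sum_le_sum key
  simp only [Finset.sum_add_distrib, Finset.sum_ite_eq', Finset.mem_univ, if_true] at this
  omega

/-- A leaf does not want to replace a hub by the third neighbour `s` of the hub, nor by another
neighbour of `s`, when the hub has sufficiently many leaves. -/
theorem not_weakUnhappySumVia_of_hub [Finite V] (hT : T.IsTree) {u v s p q l₁ l₂ l₃ w : V}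
    (huv : T.Adj u v) (hu : ∀ x, T.Adj u x → x = v) (hvs : T.Adj v s) (hsu : s ≠ u)
    (hv : ∀ y, T.Adj v y → y = s ∨ ∀ x, T.Adj y x → x = v)
    (hs : ∀ y, T.Adj s y ↔ y = v ∨ y = p ∨ y = q) (hvp : v ≠ p) (hvq : v ≠ q) (hpq : p ≠ q)
    (hl₁ : T.Adj v l₁) (hl₂ : T.Adj v l₂) (hl₃ : T.Adj v l₃)
    (hu₁ : l₁ ≠ u) (hu₂ : l₂ ≠ u) (hu₃ : l₃ ≠ u) (hs₁ : l₁ ≠ s) (hs₂ : l₂ ≠ s) (hs₃ : l₃ ≠ s)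
    (h₁₂ : l₁ ≠ l₂) (h₁₃ : l₁ ≠ l₃) (h₂₃ : l₂ ≠ l₃) (hw : w = s ∨ w = p) :
    ¬ WeakUnhappySumVia T 3 u v w := by
  classical
  have := Fintype.ofFinite V
  have hsv : T.Adj s v := hvs.symm
  have hsp : T.Adj s p := (hs p).2 (by simp)
  have hsq : T.Adj s q := (hs q).2 (by simp)
  have d1 : T.dist u v = 1 := dist_eq_one_iff_adj.2 huv
  have d2 : ∀ y, T.Adj v y → y ≠ u → T.dist u y = 2 := fun y h hne =>
    dist_eq_two hT huv h hne.symm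
  have d3 : T.dist u p = 3 := dist_eq_three hT huv hvs hsp hsu.symm hvp
  have d4 : T.dist u q = 3 := dist_eq_three hT huv hvs hsq hsu.symm hvq
  have hball : ∀ y, y ∈ ball T u 3 ↔ T.dist u y ≤ 3 := fun y => by
    rw [mem_ball, ← (hT.connected u y).coe_dist_eq_edist]
    exact Nat.cast_le
  have hcases : ∀ y, y ∈ ball T u 3 → y = u ∨ y = v ∨ (T.Adj v y ∧ y ≠ u) ∨ y = p ∨ y = q := by
    intro y hy
    obtain h | h | ⟨a, h1, h2⟩ | ⟨a, b, h1, h2, h3⟩ := exists_walk_of_edist_le_three hT hy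
    · exact .inl h
    · exact .inr (.inl (hu _ h))
    · obtain rfl := hu _ h1
      by_cases y = u <;> tauto
    · obtain rfl := hu _ h1
      obtain rfl | h := hv b h2
      · have := (hs y).1 h3
        tauto
      · exact .inr (.inl (h _ h3))
  have hwu : w ≠ u := by
    rintro rfl
    obtain rfl | rfl := hw
    · exact hsu rfl
    · simp at d3
  have hwball : w ∈ ball T u 3 := by
    rw [hball]
    obtain rfl | rfl := hw
    · rw [d2 _ hvs hsu]; omega
    · exact d3.le
  have memv : v ∈ ball T u 3 := (hball v).2 (by omega)
  have meml : ∀ y, T.Adj v y → y ≠ u → y ∈ ball T u 3 := fun y h hne =>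
    (hball y).2 (by rw [d2 y h hne]; omega)
  have memp : p ∈ ball T u 3 := (hball p).2 d3.le
  have memq : q ∈ ball T u 3 := (hball q).2 d4.le
  refine not_weakUnhappySumVia_of_ball hT.connected memv hwball
    (fun y => if y = u then 0 else T.dist w y + 1) (by simp) (by simp [hwu]) ?_ ?_
  · intro a b hab hne
    have h1 := hT.connected.dist_triangle (u := w) (v := a) (w := b)
    rw [dist_eq_one_iff_adj.2 hab] at h1
    have h2 : a ≠ u := by rintro rfl; exact hne (by rw [hu _ hab])
    have h3 : b ≠ u := by
      rintro rfl; exact hne (by rw [hu _ hab.symm, Sym2.eq_swap])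
    simp only [h2, h3, if_false]
    omega
  obtain rfl | rfl := hw
  · have key : ∀ y ∈ Finset.univ.filter (· ∈ ball T u 3),
        T.dist u y + (if y = v then 1 else 0) + (if y = l₁ then 1 else 0) +
          (if y = l₂ then 1 else 0) + (if y = l₃ then 1 else 0) ≤
        (if y = u then 0 else T.dist w y + 1) + (if y = w then 1 else 0) +
          (if y = p then 1 else 0) + (if y = q then 1 else 0) := by
      intro y hy
      have e1 : T.dist w v = 1 := dist_eq_one_iff_adj.2 hsv
      have e2 : ∀ y, T.Adj v y → y ≠ w → T.dist w y = 2 := fun y h hne =>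
        dist_eq_two hT hsv h hne.symm
      have e3 : T.dist w p = 1 := dist_eq_one_iff_adj.2 hsp
      have e4 : T.dist w q = 1 := dist_eq_one_iff_adj.2 hsq
      have e5 : T.dist u u = 0 := dist_self
      have := huv.ne
      obtain rfl | rfl | ⟨h, h'⟩ | rfl | rfl := hcases y (by simpa using hy)
      · grind
      · grind
      · by_cases hyw : y = w
        · subst hyw; grind
        · have := e2 y h hyw; have := d2 y h h'; grind
      · grind
      · grind
    have := Finset.sum_le_sum key
    simp only [Finset.sum_add_distrib, Finset.sum_ite_eq', Finset.mem_filter, Finset.mem_univ,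
      true_and, memv, memp, memq, meml _ hl₁ hu₁, meml _ hl₂ hu₂, meml _ hl₃ hu₃,
      hwball, if_true] at this
    omega
  · have key : ∀ y ∈ Finset.univ.filter (· ∈ ball T u 3),
        T.dist u y + (if y = v then 2 else 0) + (if y = l₁ then 1 else 0) ≤
        (if y = u then 0 else T.dist w y + 1) + (if y = w then 2 else 0) := by
      intro y hy
      have e0 : T.dist w s = 1 := dist_eq_one_iff_adj.2 hsp.symm
      have e1 : T.dist w v = 2 := dist_eq_two hT hsp.symm hsv hvp.symm
      have e2 : ∀ y, T.Adj v y → y ≠ s → T.dist w y = 3 := fun y h hne =>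
        dist_eq_three hT hsp.symm hsv h hvp.symm hne.symm
      have e3 : T.dist w q = 2 := dist_eq_two hT hsp.symm hsq hpq
      have e5 : T.dist u u = 0 := dist_self
      have e6 : T.dist w w = 0 := dist_self
      have := huv.ne
      obtain rfl | rfl | ⟨h, h'⟩ | rfl | rfl := hcases y (by simpa using hy)
      · grind
      · grind
      · by_cases hyw : y = s
        · subst hyw; grind
        · have := e2 y h hyw; have := d2 y h h'; grind
      · grind
      · grind
    have := Finset.sum_le_sum key
    simp only [Finset.sum_add_distrib, Finset.sum_ite_eq', Finset.mem_filter, Finset.mem_univ,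
      true_and, memv, meml _ hl₁ hu₁, hwball, if_true] at this
    omega

/-- Partition of the vertices into spine vertices, with exactly three neighbours, none of them a
leaf; hubs, adjacent to a spine vertex and otherwise to at least four leaves; and leaves. -/
structure HubbedCaterpillar (T : SimpleGraph V) (S B L : Set V) : Prop where
  cover : ∀ x, x ∈ S ∨ x ∈ B ∨ x ∈ L
  disjoint : ∀ x ∈ S, x ∉ L
  spine : ∀ s ∈ S, ∃ a b c, a ≠ b ∧ a ≠ c ∧ b ≠ c ∧ a ∉ L ∧ b ∉ L ∧ c ∉ L ∧
    ∀ y, T.Adj s y ↔ y = a ∨ y = b ∨ y = c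
  hub : ∀ h ∈ B, ∃ s ∈ S, T.Adj h s ∧ ∀ y, T.Adj h y → y = s ∨ y ∈ L
  hub_leaves : ∀ h ∈ B, ∃ l : Fin 4 → V, Function.Injective l ∧
    ∀ i, l i ∈ L ∧ T.Adj h (l i)
  leaf : ∀ x ∈ L, ∃ h ∈ B, ∀ y, T.Adj x y ↔ y = h

namespace HubbedCaterpillar

variable {S B L : Set V}

theorem exists_adj_ne (hc : HubbedCaterpillar T S B L) {x : V} (hx : x ∉ L) (v : V) :
    ∃ z, T.Adj x z ∧ z ≠ v := by
  obtain h | h | h := hc.cover x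
  · obtain ⟨a, b, c, hab, -, -, -, -, -, h⟩ := hc.spine x h
    by_cases hav : a = v
    · exact ⟨b, (h b).2 (by simp), fun hb => hab (hav.trans hb.symm)⟩
    · exact ⟨a, (h a).2 (by simp), hav⟩
  · obtain ⟨l, hl, h⟩ := hc.hub_leaves x h
    by_cases hav : l 0 = v
    · exact ⟨l 1, (h 1).2, fun hb => absurd (hl (hav.trans hb.symm)) (by decide)⟩
    · exact ⟨l 0, (h 0).2, hav⟩
  · exact absurd h hx

theorem exists_three_leaves (hc : HubbedCaterpillar T S B L) {x : V} (hx : x ∈ B) (u : V) :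
    ∃ a b c, a ≠ b ∧ a ≠ c ∧ b ≠ c ∧ a ≠ u ∧ b ≠ u ∧ c ≠ u ∧ (a ∈ L ∧ T.Adj x a) ∧
      (b ∈ L ∧ T.Adj x b) ∧ c ∈ L ∧ T.Adj x c := by
  obtain ⟨l, hl, h⟩ := hc.hub_leaves x hx
  have hne : ∀ {i j}, i ≠ j → l i ≠ l j := fun h => hl.ne h
  have key : ∀ i : Fin 4, (∀ j, j ≠ i → l j ≠ u) → ∃ a b c, a ≠ b ∧ a ≠ c ∧ b ≠ c ∧
      a ≠ u ∧ b ≠ u ∧ c ≠ u ∧ (a ∈ L ∧ T.Adj x a) ∧ (b ∈ L ∧ T.Adj x b) ∧ c ∈ L ∧ T.Adj x c := by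
    intro i hi
    have : ∀ i : Fin 4, ∃ a b c : Fin 4, a ≠ i ∧ b ≠ i ∧ c ≠ i ∧ a ≠ b ∧ a ≠ c ∧ b ≠ c := by
      decide
    obtain ⟨a, b, c, ha, hb, hc, hab, hac, hbc⟩ := this i
    exact ⟨l a, l b, l c, hne hab, hne hac, hne hbc, hi a ha, hi b hb, hi c hc, h a, h b, h c⟩
  by_cases hu : ∃ i, l i = u
  · obtain ⟨i, rfl⟩ := hu
    exact key i fun j hj => hne hj
  · push Not at hu
    exact key 0 fun j _ => hu j

theorem weakSumEquilibrium [Finite V] (hT : T.IsTree) (hc : HubbedCaterpillar T S B L) :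
    WeakSumEquilibrium T 3 := by
  rintro u ⟨v, w, hun⟩
  have hval := hun.1
  obtain ⟨huv, -, hna, hne⟩ := hun.1
  by_cases hw : w ∈ branch T u v
  swap
  · exact not_weakUnhappySumVia_of_notMem_branch hT huv hw hun
  obtain ⟨x, hvx, hxu, hx⟩ : ∃ x, T.Adj v x ∧ x ≠ u ∧ (w = x ∨ T.Adj x w ∧ w ≠ v) := by
    obtain h | ⟨x, h1, h2, h3, h4⟩ := hval.child_or_grandchild hT hw
    · exact ⟨w, h, hne, .inl rfl⟩
    · exact ⟨x, h1, h3, .inr ⟨h2, h4⟩⟩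
  obtain hv | hv | hv := hc.cover v
  · obtain ⟨y, hvy, hyu, hyx, hyL⟩ : ∃ y, T.Adj v y ∧ y ≠ u ∧ y ≠ x ∧ y ∉ L := by
      obtain ⟨a, b, c, hab, hac, hbc, ha, hb, hcL, h⟩ := hc.spine v hv
      have h1 := (h u).1 huv.symm
      have h2 := (h x).1 hvx
      have h3 := (h a).2 (by simp)
      have h4 := (h b).2 (by simp)
      have h5 := (h c).2 (by simp)
      grind
    obtain ⟨z, hyz, hzv⟩ := hc.exists_adj_ne hyL v
    have hyB : y ∈ branch T u v := mem_branch_of_adj mem_branch_self hvy (by simp [hyu, huv.ne'])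
    have hzB : z ∈ branch T u v := mem_branch_of_adj hyB hyz (by simp [hyu, hvy.ne'])
    refine not_weakUnhappySumVia_of_far hT huv hw hzB
      (dist_eq_three hT huv hvy hyz hyu.symm hzv.symm) ?_ hun
    obtain rfl | ⟨hxw, hwv⟩ := hx
    · exact (dist_eq_three hT hvx.symm hvy hyz hyx.symm hzv.symm).ge
    · rw [dist_eq_four hT hxw.symm hvx.symm hvy hyz hwv hyx.symm hzv.symm]
      omega
  · obtain ⟨s, hs, hvs, h⟩ := hc.hub v hv
    have hleaf : ∀ y, T.Adj v y → y = s ∨ ∀ z, T.Adj y z → z = v := fun y hy => by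
      refine (h y hy).imp_right fun hyL z hz => ?_
      obtain ⟨h', -, hh'⟩ := hc.leaf y hyL
      rw [(hh' z).1 hz, ← (hh' v).1 hy.symm]
    obtain ⟨l₁, l₂, l₃, h₁₂, h₁₃, h₂₃, hu₁, hu₂, hu₃, ⟨m₁, a₁⟩, ⟨m₂, a₂⟩, m₃, a₃⟩ :=
      hc.exists_three_leaves hv u
    by_cases hxs : x = s
    · subst hxs
      have huL := (hleaf u huv.symm).resolve_left hxu.symm
      have hsl : ∀ {l}, l ∈ L → l ≠ x := fun hl => by
        rintro rfl
        exact hc.disjoint _ hs hl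
      obtain ⟨p, q, hpq, hvp, hvq, hadj⟩ :
          ∃ p q, p ≠ q ∧ v ≠ p ∧ v ≠ q ∧ ∀ y, T.Adj x y ↔ y = v ∨ y = p ∨ y = q := by
        obtain ⟨a, b, c, hab, hac, hbc, -, -, -, h⟩ := hc.spine x hs
        obtain rfl | rfl | rfl := (h v).1 hvx.symm
        · exact ⟨b, c, hbc, hab, hac, h⟩
        · exact ⟨a, c, hac, hab.symm, hbc, fun y => by rw [h]; tauto⟩
        · exact ⟨a, b, hab, hac.symm, hbc.symm, fun y => by rw [h]; tauto⟩
      obtain hw | rfl : (w = x ∨ w = p) ∨ w = q := by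
        obtain h | ⟨h, h'⟩ := hx
        · exact .inl (.inl h)
        · have := (hadj w).1 h
          tauto
      · exact not_weakUnhappySumVia_of_hub hT huv huL hvs hxu hleaf hadj hvp hvq hpq a₁ a₂ a₃
          hu₁ hu₂ hu₃ (hsl m₁) (hsl m₂) (hsl m₃) h₁₂ h₁₃ h₂₃ hw hun
      · exact not_weakUnhappySumVia_of_hub hT huv huL hvs hxu hleaf
          (fun y => (hadj y).trans (by tauto)) hvq hvp hpq.symm a₁ a₂ a₃
          hu₁ hu₂ hu₃ (hsl m₁) (hsl m₂) (hsl m₃) h₁₂ h₁₃ h₂₃ (.inr rfl) hun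
    · have hxl := (hleaf x hvx).resolve_left hxs
      obtain rfl | ⟨hxw, hwv⟩ := hx
      · by_cases hl : l₁ = w
        · exact not_weakUnhappySumVia_leaf hT huv hvx hxu hxl a₂ (hl ▸ h₁₂.symm) hu₂ hun
        · exact not_weakUnhappySumVia_leaf hT huv hvx hxu hxl a₁ hl hu₁ hun
      · exact hwv (hxl w hxw)
  · obtain ⟨h, -, hh⟩ := hc.leaf v hv
    exact hxu (((hh x).1 hvx).trans ((hh u).1 huv.symm).symm)

end HubbedCaterpillar

end Equilibrium

section Construction

/-- The graph on `Fin n` in which every `i > 0` is joined to its parent `par i`. -/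
def parentGraph (n : ℕ) (par : ℕ → ℕ) : SimpleGraph (Fin n) where
  Adj a b := a ≠ b ∧ (a.val = par b.val ∨ b.val = par a.val)
  symm := ⟨fun _ _ h => ⟨h.1.symm, h.2.symm⟩⟩
  loopless := ⟨fun _ h => h.1 rfl⟩

theorem parentGraph_adj {n : ℕ} {par : ℕ → ℕ} {a b : Fin n} :
    (parentGraph n par).Adj a b ↔ a.val ≠ b.val ∧ (a.val = par b.val ∨ b.val = par a.val) := by
  rw [Fin.val_ne_iff]
  rfl

theorem isTree_parentGraph {n : ℕ} {par : ℕ → ℕ} (h0 : par 0 = 0)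
    (hpar : ∀ i, 0 < i → par i < i) (hn : 0 < n) : (parentGraph n par).IsTree := by
  obtain ⟨k, rfl⟩ := Nat.exists_eq_add_of_lt hn
  rw [zero_add] at *
  rw [isTree_iff_connected_and_card]
  constructor
  · rw [connected_iff_exists_forall_reachable]
    refine ⟨0, ?_⟩
    rintro ⟨i, hi⟩
    induction i using Nat.strong_induction_on with
    | _ i ih =>
      rcases Nat.eq_zero_or_pos i with rfl | hpos
      · exact Reachable.refl _
      · have := hpar i hpos
        refine (ih (par i) this (this.trans hi)).trans (Adj.reachable ?_)
        rw [parentGraph_adj]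
        exact ⟨this.ne, .inl rfl⟩
  · have hlt : ∀ i : Fin k, par (i + 1) < k + 1 := fun i => by
      have := hpar (i + 1) (by omega)
      omega
    let e : Fin k → (parentGraph (k + 1) par).edgeSet := fun i =>
      ⟨s(i.succ, ⟨par (i + 1), hlt i⟩), by
        have := hpar (i + 1) (by omega)
        rw [mem_edgeSet, parentGraph_adj]
        exact ⟨by simp only [Fin.val_succ]; omega, .inr (by simp)⟩⟩
    have he : Function.Bijective e := by
      constructor
      · intro i j hij
        have h1 := hpar (i + 1) (by omega)
        have h2 := hpar (j + 1) (by omega)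
        simp only [e, Subtype.mk.injEq, Sym2.eq_iff, Fin.ext_iff, Fin.val_succ] at hij
        ext
        omega
      · rintro ⟨x, hx⟩
        induction x with | _ a b
        rw [mem_edgeSet, parentGraph_adj] at hx
        have key : ∀ a b : Fin (k + 1), a.val ≠ b.val → a.val = par b.val →
            ∃ i, (e i : Sym2 (Fin (k + 1))) = s(a, b) := by
          intro a b hne h
          have hb : 0 < b.val := by
            rcases Nat.eq_zero_or_pos b.val with hb | hb
            · rw [hb, h0] at h
              omega
            · exact hb
          refine ⟨⟨b - 1, by omega⟩, ?_⟩
          have hb' : b.val - 1 + 1 = b.val := by omega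
          simp [e, Fin.ext_iff, hb', h]
        obtain ⟨hne, h | h⟩ := hx
        · obtain ⟨i, hi⟩ := key a b hne h
          exact ⟨i, Subtype.ext hi⟩
        · obtain ⟨i, hi⟩ := key b a hne.symm h
          exact ⟨i, Subtype.ext (hi.trans Sym2.eq_swap)⟩
    rw [← Nat.card_eq_of_bijective e he]
    simp

/-- Spine `0, …, m - 1`, hubs `m, …, 2m + 1`, then four leaves for each hub, with all further
leaves at the last hub. -/
def caterpillarParent (m i : ℕ) : ℕ :=
  if i < m then i - 1 else if i < 2 * m then i - m else if i = 2 * m then 0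
  else if i = 2 * m + 1 then m - 1 else m + min ((i - (2 * m + 2)) / 4) (m + 1)

theorem isTree_caterpillar {m n : ℕ} (hm : 0 < m) (hn : 0 < n) :
    (parentGraph n (caterpillarParent m)).IsTree := by
  refine isTree_parentGraph ?_ (fun i hi => ?_) hn
  · simp [caterpillarParent, hm]
  · unfold caterpillarParent
    split_ifs <;> omega

theorem hubbedCaterpillar_caterpillar {m n : ℕ} (hm : 0 < m) (hn : 6 * m + 10 ≤ n) :
    HubbedCaterpillar (parentGraph n (caterpillarParent m)) {x | x.val < m}
      {x | m ≤ x.val ∧ x.val < 2 * m + 2} {x | 2 * m + 2 ≤ x.val} where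
  cover x := by
    simp only [Set.mem_ofPred_eq]
    omega
  disjoint x := by
    simp only [Set.mem_ofPred_eq]
    omega
  spine s hs := by
    simp only [Set.mem_ofPred_eq] at hs ⊢
    refine ⟨⟨if s.val = 0 then 2 * m else s - 1, by split_ifs <;> omega⟩,
      ⟨if s.val = m - 1 then 2 * m + 1 else s + 1, by split_ifs <;> omega⟩,
      ⟨m + s, by omega⟩, ?_⟩
    simp only [ne_eq, Fin.ext_iff, parentGraph_adj]
    refine ⟨by split_ifs <;> omega, by split_ifs <;> omega, by split_ifs <;> omega,
      by split_ifs <;> omega, by split_ifs <;> omega, by omega, fun y => ?_⟩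
    have := y.isLt
    unfold caterpillarParent
    split_ifs <;> omega
  hub h hh := by
    simp only [Set.mem_ofPred_eq] at hh ⊢
    refine ⟨⟨caterpillarParent m h, ?_⟩, ?_, ?_, fun y => ?_⟩
    · unfold caterpillarParent
      split_ifs <;> omega
    · unfold caterpillarParent
      split_ifs <;> simp only <;> omega
    · rw [parentGraph_adj]
      refine ⟨?_, .inr rfl⟩
      unfold caterpillarParent
      split_ifs <;> simp only <;> omega
    · rw [parentGraph_adj, Fin.ext_iff]
      unfold caterpillarParent
      split_ifs <;> simp only <;> omega
  hub_leaves h hh := by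
    simp only [Set.mem_ofPred_eq] at hh ⊢
    refine ⟨fun i => ⟨2 * m + 2 + 4 * (h - m) + i, by omega⟩, fun i j hij => ?_, fun i => ?_⟩
    · simp only [Fin.mk.injEq] at hij
      omega
    · obtain ⟨t, ht⟩ := Nat.exists_eq_add_of_le hh.1
      have := i.isLt
      simp only [parentGraph_adj, ht, Nat.add_sub_cancel_left]
      refine ⟨by omega, by omega, .inl ?_⟩
      unfold caterpillarParent
      split_ifs <;> omega
  leaf x hx := by
    simp only [Set.mem_ofPred_eq] at hx ⊢
    refine ⟨⟨caterpillarParent m x, ?_⟩, ?_, fun y => ?_⟩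
    · unfold caterpillarParent
      split_ifs <;> omega
    · unfold caterpillarParent
      split_ifs <;> simp only <;> omega
    · rw [parentGraph_adj, Fin.ext_iff]
      unfold caterpillarParent
      split_ifs <;> simp only <;> omega

/-- The spine neighbour of the hub `m + t` of the caterpillar. -/
def hubPosition (m t : ℕ) : ℕ :=
  if t < m then t else if t = m then 0 else m - 1

/-- The spine vertex closest to a given vertex of the caterpillar. -/
def spinePosition (m i : ℕ) : ℕ :=
  if i < m then i else if i < 2 * m + 2 then hubPosition m (i - m)
  else hubPosition m (min ((i - (2 * m + 2)) / 4) (m + 1))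

theorem spinePosition_caterpillarParent {m : ℕ} (hm : 0 < m) (i : ℕ) :
    spinePosition m (caterpillarParent m i) ≤ spinePosition m i ∧
      spinePosition m i ≤ spinePosition m (caterpillarParent m i) + 1 := by
  rcases lt_or_ge i (2 * m + 2) with hi | hi
  · unfold spinePosition hubPosition caterpillarParent
    split_ifs <;> omega
  · have h : caterpillarParent m i = m + min ((i - (2 * m + 2)) / 4) (m + 1) := by
      unfold caterpillarParent
      split_ifs <;> omega
    have h' : spinePosition m (caterpillarParent m i) = spinePosition m i := by
      rw [h, spinePosition, spinePosition, if_neg (by omega), if_pos (by omega),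
        if_neg (by omega), if_neg (by omega), Nat.add_sub_cancel_left]
    omega

theorem spinePosition_le {m : ℕ} {n : ℕ} (hm : 0 < m) {a b : Fin n}
    (h : (parentGraph n (caterpillarParent m)).Adj a b) :
    spinePosition m a ≤ spinePosition m b + 1 := by
  rw [parentGraph_adj] at h
  obtain ⟨-, h | h⟩ := h <;> rw [h]
  · exact (spinePosition_caterpillarParent hm b).1.trans (Nat.le_succ _)
  · exact (spinePosition_caterpillarParent hm a).2

theorem dist_caterpillar_ge {m n : ℕ} (hm : 0 < m) (hn : 0 < n) (a b : Fin n) :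
    spinePosition m a - spinePosition m b ≤ (parentGraph n (caterpillarParent m)).dist a b := by
  have hT := (isTree_caterpillar hm hn).connected
  have := le_edist_of_potential (H := parentGraph n (caterpillarParent m)) (u := b)
    (f := fun a => spinePosition m a - spinePosition m b) (by simp) (fun x y h => by
      have := spinePosition_le hm h.symm
      omega) a
  rw [← (hT b a).coe_dist_eq_edist, dist_comm] at this
  exact_mod_cast this

theorem six_mul_sum_sub (m : ℕ) :
    6 * ∑ i ∈ Finset.range m, ∑ j ∈ Finset.range m, (i - j) + m = m ^ 3 := by
  induction m with
  | zero => simp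
  | succ m ih =>
    have h1 : ∀ i ∈ Finset.range m, ∑ j ∈ Finset.range (m + 1), (i - j) =
        ∑ j ∈ Finset.range m, (i - j) := fun i hi => by
      rw [Finset.sum_range_succ, Nat.sub_eq_zero_of_le (Finset.mem_range.1 hi).le, add_zero]
    have h2 : (∑ j ∈ Finset.range (m + 1), (m - j)) * 2 = (m + 1) * m := by
      have := Finset.sum_range_id_mul_two (m + 1)
      rwa [← Finset.sum_range_reflect, Nat.add_sub_cancel] at this
    rw [Finset.sum_range_succ, Finset.sum_congr rfl h1]
    nlinarith

theorem sub_one_mul_le_scSum {n : ℕ} {T : SimpleGraph (Fin n)} (hT : T.Connected) :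
    n * (n - 1) ≤ scSum T := by
  have : ∀ u ∈ Finset.univ, n - 1 ≤ ∑ v, T.dist u v := fun u _ => by
    rw [← Finset.add_sum_erase _ _ (Finset.mem_univ u)]
    have := Finset.card_nsmul_le_sum (Finset.univ.erase u) (fun v => T.dist u v) 1
      (fun v hv => hT.pos_dist_of_ne (Finset.ne_of_mem_erase hv).symm)
    simp only [Finset.card_erase_of_mem (Finset.mem_univ u), Finset.card_univ, Fintype.card_fin,
      smul_eq_mul, mul_one] at this
    omega
  simpa [scSum] using Finset.card_nsmul_le_sum _ _ _ this

theorem scSum_le_pow {n : ℕ} {T : SimpleGraph (Fin n)} (hT : T.Connected) :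
    scSum T ≤ n ^ 3 := by
  have : ∀ u ∈ Finset.univ, ∀ v ∈ Finset.univ, T.dist u v ≤ n := fun u _ v _ => by
    obtain ⟨p, hp, hl⟩ := hT.exists_path_of_dist u v
    rw [← hl]
    simpa using hp.length_lt.le
  calc scSum T ≤ ∑ _u : Fin n, ∑ _v : Fin n, n :=
        Finset.sum_le_sum fun u hu => Finset.sum_le_sum fun v hv => this u hu v hv
    _ = n ^ 3 := by simp; ring

theorem pow_le_scSum_caterpillar {m n : ℕ} (hm : 0 < m) (hn : 6 * m + 10 ≤ n) :
    m ^ 3 ≤ 7 * scSum (parentGraph n (caterpillarParent m)) := by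
  have h1 := six_mul_sum_sub m
  have h2 := sub_one_mul_le_scSum (isTree_caterpillar (n := n) hm (by omega)).connected
  have h3 : ∑ i ∈ Finset.range m, ∑ j ∈ Finset.range m, (i - j) ≤
      scSum (parentGraph n (caterpillarParent m)) := by
    have hsub : Finset.range m ⊆ Finset.range n := Finset.range_mono (by omega)
    calc ∑ i ∈ Finset.range m, ∑ j ∈ Finset.range m, (i - j)
        = ∑ i ∈ Finset.range m, ∑ j ∈ Finset.range m, (spinePosition m i - spinePosition m j) := by
          refine Finset.sum_congr rfl fun i hi => Finset.sum_congr rfl fun j hj => ?_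
          rw [Finset.mem_range] at hi hj
          simp [spinePosition, hi, hj]
      _ ≤ ∑ i ∈ Finset.range n, ∑ j ∈ Finset.range n, (spinePosition m i - spinePosition m j) :=
          (Finset.sum_le_sum fun i _ => Finset.sum_le_sum_of_subset hsub).trans
            (Finset.sum_le_sum_of_subset hsub)
      _ = ∑ i : Fin n, ∑ j : Fin n, (spinePosition m i - spinePosition m j) := by
          rw [← Fin.sum_univ_eq_sum_range
            (fun i => ∑ j ∈ Finset.range n, (spinePosition m i - spinePosition m j))]
          refine Finset.sum_congr rfl fun i _ => ?_
          rw [← Fin.sum_univ_eq_sum_range (fun j => spinePosition m i - spinePosition m j)]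
      _ ≤ _ := Finset.sum_le_sum fun i _ => Finset.sum_le_sum fun j _ =>
          dist_caterpillar_ge hm (by omega) i j
  have h4 : n * 1 ≤ n * (n - 1) := Nat.mul_le_mul_left _ (by omega)
  omega

theorem exists_isTree_scSum_le {n : ℕ} (hn : 0 < n) :
    ∃ T : SimpleGraph (Fin n), T.IsTree ∧ scSum T ≤ 2 * n ^ 2 := by
  have : NeZero n := ⟨hn.ne'⟩
  refine ⟨starGraph 0, isTree_starGraph 0, ?_⟩
  have hd : ∀ u ∈ Finset.univ, ∀ v ∈ Finset.univ, (starGraph (0 : Fin n)).dist u v ≤ 2 := by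
    intro u _ v _
    have h1 : ∀ v : Fin n, (starGraph (0 : Fin n)).dist 0 v ≤ 1 := fun v => by
      by_cases h : v = 0
      · simp [h]
      · exact (dist_eq_one_iff_adj.2 (by simp [Ne.symm h])).le
    have := (isTree_starGraph (0 : Fin n)).connected.dist_triangle (u := u) (v := 0) (w := v)
    rw [dist_comm (u := u) (v := 0)] at this
    have := h1 u
    have := h1 v
    omega
  calc scSum (starGraph (0 : Fin n)) ≤ ∑ _u : Fin n, ∑ _v : Fin n, 2 :=
        Finset.sum_le_sum fun u hu => Finset.sum_le_sum fun v hv => hd u hu v hv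
    _ = 2 * n ^ 2 := by simp; ring

end Construction

theorem stmt17 : ∃ c₁ c₂ : ℚ, 0 < c₁ ∧ 0 < c₂ ∧
    ∀ n : ℕ, 16 ≤ n →
      c₁ * n ≤ PoA n (fun T => WeakSumEquilibrium T 3) scSum ∧
      PoA n (fun T => WeakSumEquilibrium T 3) scSum ≤ c₂ * n := by
  refine ⟨1 / (14 * 21 ^ 3), 2, by norm_num, by norm_num, fun n hn => ?_⟩
  rw [PoA]
  set A := {m : ℕ | ∃ T : SimpleGraph (Fin n), T.IsTree ∧ WeakSumEquilibrium T 3 ∧ scSum T = m}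
  set M := {m : ℕ | ∃ T : SimpleGraph (Fin n), T.IsTree ∧ scSum T = m}
  have hA : ∀ a ∈ A, a ≤ n ^ 3 := by
    rintro a ⟨T, hT, -, rfl⟩
    exact scSum_le_pow hT.connected
  have hn3 : n ^ 3 ≤ 7 * 21 ^ 3 * sSup A := by
    have hm : 0 < (n - 10) / 6 := by omega
    have hmn : 6 * ((n - 10) / 6) + 10 ≤ n := by omega
    have h1 := pow_le_scSum_caterpillar hm hmn
    have hT := isTree_caterpillar (n := n) hm (by omega)
    have h2 : scSum (parentGraph n (caterpillarParent ((n - 10) / 6))) ≤ sSup A :=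
      le_csSup (s := A) ⟨n ^ 3, hA⟩
        ⟨_, hT, (hubbedCaterpillar_caterpillar hm hmn).weakSumEquilibrium hT, rfl⟩
    have h3 : n ^ 3 ≤ (21 * ((n - 10) / 6)) ^ 3 := Nat.pow_le_pow_left (by omega) 3
    rw [mul_pow] at h3
    omega
  have hAle : sSup A ≤ n ^ 3 := csSup_le' hA
  obtain ⟨T₀, hT₀, hle₀⟩ := exists_isTree_scSum_le (n := n) (by omega)
  have hM2 : sInf M ≤ 2 * n ^ 2 := (Nat.sInf_le (show scSum T₀ ∈ M from ⟨T₀, hT₀, rfl⟩)).trans hle₀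
  have hM1 : n * (n - 1) ≤ sInf M := by
    obtain ⟨T, hT, h⟩ : sInf M ∈ M := Nat.sInf_mem ⟨_, T₀, hT₀, rfl⟩
    rw [← h]
    exact sub_one_mul_le_scSum hT.connected
  have hM3 : n ^ 2 ≤ 2 * sInf M := by
    have : n * n ≤ n * (2 * (n - 1)) := Nat.mul_le_mul_left _ (by omega)
    nlinarith
  have hn0 : (0 : ℚ) < n := by exact_mod_cast (by omega : 0 < n)
  have hMpos : (0 : ℚ) < (sInf M : ℕ) := by
    have : 0 < n ^ 2 := by positivity
    exact_mod_cast (by omega : 0 < sInf M)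
  have q1 : (n : ℚ) ^ 3 ≤ 7 * 21 ^ 3 * (sSup A : ℕ) := by exact_mod_cast hn3
  have q2 : ((sSup A : ℕ) : ℚ) ≤ n ^ 3 := by exact_mod_cast hAle
  have q3 : ((sInf M : ℕ) : ℚ) ≤ 2 * n ^ 2 := by exact_mod_cast hM2
  have q4 : (n : ℚ) ^ 2 ≤ 2 * (sInf M : ℕ) := by exact_mod_cast hM3
  constructor
  · rw [le_div_iff₀ hMpos]
    have := mul_le_mul_of_nonneg_left q3 hn0.le
    nlinarith
  · rw [div_le_iff₀ hMpos]
    have := mul_le_mul_of_nonneg_left q4 hn0.le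
    nlinarith

end SwapGame
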